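/- Let d ≥ 2 and let F = {f : B_1^d → ℝ : ‖f‖_{L∞(B_1^d)} ≤ 1 and |f|_{V_g} ≤ 1}. There exist a constant c_d > 0 and an integer n₀, depending only on d, such that for every n ≥ n₀ the following noiseless minimax lower bound holds: for every estimator f̂, i.e. every measurable map from datasets D_n ∈ (B_1^d × ℝ)^n to L²(B_1^d), there exists f ∈ F such that E‖f̂(D_n) − f‖²_{L²(B_1^d)} ≥ c_d n^{−2/(d+1)}, where the expectation is over D_n = ((x_1, f(x_1)),…,(x_n, f(x_n))) with x_1,…,x_n i.i.d. Uniform(B_1^d) (noiseless labels y_i = f(x_i)). -/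

import Mathlib

open MeasureTheory Real Filter ProbabilityTheory
open scoped ENNReal Classical BigOperators

noncomputable section

abbrev Euc (d : ℕ) : Type := EuclideanSpace ℝ (Fin d)

def relu (t : ℝ) : ℝ := max t 0

abbrev ParamIx (d K : ℕ) : Type := (Fin K × Fin d) ⊕ (Fin K ⊕ (Fin K ⊕ Unit))

abbrev Params (d K : ℕ) : Type := EuclideanSpace ℝ (ParamIx d K)

/-- input-layer weight `w_k j` -/
def wP {d K : ℕ} (θ : Params d K) (k : Fin K) (j : Fin d) : ℝ := θ (Sum.inl (k, j))
/-- input-layer bias `b_k` -/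
def bP {d K : ℕ} (θ : Params d K) (k : Fin K) : ℝ := θ (Sum.inr (Sum.inl k))
/-- output-layer weight `v_k` -/
def vP {d K : ℕ} (θ : Params d K) (k : Fin K) : ℝ := θ (Sum.inr (Sum.inr (Sum.inl k)))
/-- output bias `β` -/
def betaP {d K : ℕ} (θ : Params d K) : ℝ := θ (Sum.inr (Sum.inr (Sum.inr ())))

/-- two-layer ReLU network `f_θ(x) = Σ_k v_k relu(w_kᵀ x − b_k) + β` -/
def netFun {d K : ℕ} (θ : Params d K) (x : Euc d) : ℝ :=
  (∑ k, vP θ k * relu ((∑ j, wP θ k j * x j) - bP θ k)) + betaP θ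

/-- empirical squared loss -/
def empLoss {d K : ℕ} (n : ℕ) (x : Fin n → Euc d) (y : Fin n → ℝ) (θ : Params d K) : ℝ :=
  (1 / (2 * (n : ℝ))) * ∑ i, (y i - netFun θ (x i)) ^ 2

/-- Hessian quadratic form `vᵀ ∇²L(θ) v` -/
def hessQF {E : Type*} [NormedAddCommGroup E] [NormedSpace ℝ E] (L : E → ℝ) (θ v : E) : ℝ :=
  iteratedFDeriv ℝ 2 L θ ![v, v]

/-- largest eigenvalue of the (symmetric) Hessian of `L` at `θ` -/
def lambdaMax {E : Type*} [NormedAddCommGroup E] [NormedSpace ℝ E] (L : E → ℝ) (θ : E) : ℝ :=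
  ⨆ v : {v : E // ‖v‖ = 1}, hessQF L θ v.1

/-- weighted variation seminorm -/
def VgSeminorm (d : ℕ) (R : ℝ) (g : Euc d × ℝ → ℝ) (f : Euc d → ℝ) : ℝ≥0∞ :=
  sInf { m : ℝ≥0∞ |
    ∃ (ν : MeasureTheory.SignedMeasure (Euc d × ℝ)) (c : Euc d) (c₀ : ℝ),
      ν.totalVariation ((Metric.sphere (0 : Euc d) 1 ×ˢ Set.Icc (-R) R)ᶜ) = 0 ∧
      (∀ x ∈ Metric.closedBall (0 : Euc d) R,
        f x = (∫ p : Euc d × ℝ, relu ((∑ j, p.1 j * x j) - p.2)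
                  ∂ν.toJordanDecomposition.posPart)
              - (∫ p : Euc d × ℝ, relu ((∑ j, p.1 j * x j) - p.2)
                  ∂ν.toJordanDecomposition.negPart)
              + (∑ j, c j * x j) + c₀) ∧
      m = ∫⁻ p, ENNReal.ofReal (g p) ∂ν.totalVariation }

def gTilde {d : ℕ} (n : ℕ) (x : Fin n → Euc d) (u : Euc d) (t : ℝ) : ℝ :=
  (((Finset.univ.filter fun i => t < ∑ j, u j * x i j).card : ℝ) / (n : ℝ)) ^ 2 *
    ((∑ i ∈ Finset.univ.filter fun i => t < ∑ j, u j * x i j, ((∑ j, u j * x i j) - t)) /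
      ((Finset.univ.filter fun i => t < ∑ j, u j * x i j).card : ℝ)) *
    Real.sqrt (1 + ‖(((Finset.univ.filter fun i => t < ∑ j, u j * x i j).card : ℝ))⁻¹ •
      ∑ i ∈ Finset.univ.filter fun i => t < ∑ j, u j * x i j, x i‖ ^ 2)

def gData {d : ℕ} (n : ℕ) (x : Fin n → Euc d) : Euc d × ℝ → ℝ :=
  fun p => min (gTilde n x p.1 p.2) (gTilde n x (-p.1) (-p.2))

def gPow (d : ℕ) : Euc d × ℝ → ℝ :=
  fun p => if |p.2| ≤ 1 then (1 - |p.2|) ^ (d + 2) else 0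

def uniformBall (d : ℕ) : Measure (Euc d) :=
  (volume (Metric.closedBall (0 : Euc d) 1))⁻¹ • volume.restrict (Metric.closedBall 0 1)

instance (d : ℕ) : IsProbabilityMeasure (uniformBall d) := by
  constructor
  rw [uniformBall, Measure.smul_apply, Measure.restrict_apply MeasurableSet.univ,
    Set.univ_inter, smul_eq_mul, ENNReal.inv_mul_cancel]
  · exact (Metric.measure_closedBall_pos volume (0 : Euc d) one_pos).ne'
  · exact (isCompact_closedBall _ _).measure_lt_top.ne

/-- set of stable solutions for the dataset `(x, y)` -/
def FStable (d : ℕ) (η : ℝ) {n : ℕ} (x : Fin n → Euc d) (y : Fin n → ℝ) (f : Euc d → ℝ) : Prop :=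
  ∃ (K : ℕ) (θ : Params d K),
    (∀ z, f z = netFun θ z) ∧
    ContDiffAt ℝ 2 (empLoss n x y) θ ∧
    lambdaMax (empLoss n x y) θ ≤ 2 / η

/-- membership in the (unweighted) variation ball `V_C(B_1^d)` -/
def memVC (d : ℕ) (C : ℝ) (f : Euc d → ℝ) : Prop :=
  ∃ (ν : MeasureTheory.SignedMeasure (Euc d × ℝ)) (c : Euc d) (b : ℝ),
    ν.totalVariation ((Metric.sphere (0 : Euc d) 1 ×ˢ Set.Icc (-1 : ℝ) 1)ᶜ) = 0 ∧
    ν.totalVariation Set.univ ≤ ENNReal.ofReal C ∧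
    ∀ x ∈ Metric.closedBall (0 : Euc d) 1,
      f x = (∫ p : Euc d × ℝ, relu ((∑ j, p.1 j * x j) - p.2)
                ∂ν.toJordanDecomposition.posPart)
            - (∫ p : Euc d × ℝ, relu ((∑ j, p.1 j * x j) - p.2)
                ∂ν.toJordanDecomposition.negPart)
            + (∑ j, c j * x j) + b


lemma assouad {d n : ℕ} (fhat : (Fin n → Euc d × ℝ) → Euc d → ℝ)
    (hm : Measurable (fun p : (Fin n → Euc d × ℝ) × Euc d => fhat p.1 p.2))
    {ι : Type} [Fintype ι] (φ : ι → Euc d → ℝ) (hφ : ∀ k, Measurable (φ k))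
    (C : ι → Set (Euc d)) (hC : ∀ k, MeasurableSet (C k))
    (hdis : ∀ k l, k ≠ l → Disjoint (C k) (C l))
    (hsub : ∀ k, C k ⊆ Metric.closedBall (0 : Euc d) 1)
    (μ : Measure (Euc d)) [IsProbabilityMeasure μ] (a b : ℝ≥0∞)
    (hP : ∀ k, a ≤ (Measure.pi fun _ : Fin n => μ) {ω | ∀ i, φ k (ω i) = 0})
    (hI : ∀ k, b ≤ ∫⁻ z in C k, ENNReal.ofReal (φ k z ^ 2 / 2)) :
    ∃ σ : ι → Bool, (Fintype.card ι : ℝ≥0∞) * (a * b) / 2 ≤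
      ∫⁻ ω, ∫⁻ z in Metric.closedBall (0 : Euc d) 1,
        ENNReal.ofReal ((fhat (fun i => (ω i, ∑ k, if σ k then φ k (ω i) else 0)) z
          - ∑ k, if σ k then φ k z else 0) ^ 2) ∂volume
        ∂(Measure.pi fun _ : Fin n => μ) := by
  set f : (ι → Bool) → Euc d → ℝ := fun σ z => ∑ k, if σ k then φ k z else 0 with hf
  have hfm : ∀ σ, Measurable (f σ) := by
    intro σ
    refine Finset.measurable_fun_sum _ fun k _ => ?_
    by_cases h : σ k = true
    · simpa [h] using hφ k
    · simp [h]
  set F : (ι → Bool) → (Fin n → Euc d) → Euc d → ℝ≥0∞ := fun σ ω z =>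
    ENNReal.ofReal ((fhat (fun i => (ω i, f σ (ω i))) z - f σ z) ^ 2) with hF
  have hFm : ∀ σ, Measurable (fun p : (Fin n → Euc d) × Euc d => F σ p.1 p.2) := by
    intro σ
    have h1 : Measurable (fun p : (Fin n → Euc d) × Euc d =>
        fhat (fun i => (p.1 i, f σ (p.1 i))) p.2) := by
      refine hm.comp (Measurable.prodMk ?_ measurable_snd)
      refine measurable_pi_lambda _ fun i => ?_
      have : Measurable fun p : (Fin n → Euc d) × Euc d => p.1 i :=
        (measurable_pi_apply i).comp measurable_fst
      exact this.prodMk ((hfm σ).comp this)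
    exact ((h1.sub ((hfm σ).comp measurable_snd)).pow_const 2).ennreal_ofReal
  set P := (Measure.pi fun _ : Fin n => μ) with hPdef
  set A : ι → Set (Fin n → Euc d) := fun k => {ω | ∀ i, φ k (ω i) = 0} with hA
  have hAm : ∀ k, MeasurableSet (A k) := by
    intro k
    have : A k = ⋂ i, {ω | φ k (ω i) = 0} := by ext; simp [hA]
    rw [this]
    refine MeasurableSet.iInter fun i => ?_
    exact ((hφ k).comp (measurable_pi_apply i)) (measurableSet_singleton 0)
  have hGm : ∀ σ k, Measurable (fun ω => ∫⁻ z in C k, F σ ω z) := fun σ k =>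
    Measurable.lintegral_prod_right' (hFm σ)
  set Q : ι → (ι → Bool) → ℝ≥0∞ := fun k σ => ∫⁻ ω in A k, ∫⁻ z in C k, F σ ω z ∂volume ∂P with hQ
  set R : (ι → Bool) → ℝ≥0∞ := fun σ =>
    ∫⁻ ω, ∫⁻ z in Metric.closedBall (0 : Euc d) 1, F σ ω z ∂volume ∂P with hR
  have step1 : ∀ σ, ∑ k, Q k σ ≤ R σ := by
    intro σ
    calc ∑ k, Q k σ ≤ ∑ k, ∫⁻ ω, ∫⁻ z in C k, F σ ω z ∂volume ∂P :=
          Finset.sum_le_sum fun k _ => setLIntegral_le_lintegral _ _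
      _ = ∫⁻ ω, ∑ k, ∫⁻ z in C k, F σ ω z ∂volume ∂P :=
          (lintegral_finsetSum _ fun k _ => hGm σ k).symm
      _ ≤ R σ := by
          refine lintegral_mono fun ω => ?_
          dsimp only
          rw [← lintegral_biUnion_finset (fun k _ l _ h => hdis k l h) (fun k _ => hC k)]
          exact lintegral_mono_set (by simpa using hsub)
  let flip : ι → (ι → Bool) → (ι → Bool) := fun k σ => Function.update σ k (!σ k)
  have hflip : ∀ k, Function.Involutive (flip k) := by
    intro k σ
    funext j
    by_cases h : j = k
    · subst h; simp [flip]
    · simp [flip, h]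
  have hff : ∀ k σ z, (f σ z - f (flip k σ) z) ^ 2 = φ k z ^ 2 := by
    intro k σ z
    have : f σ z - f (flip k σ) z =
        (if σ k then φ k z else 0) - (if (flip k σ) k then φ k z else 0) := by
      simp only [hf]
      rw [← Finset.sum_sub_distrib]
      refine Finset.sum_eq_single k (fun j _ h => ?_) (by simp)
      simp [flip, h]
    rw [this]
    cases h : σ k <;> simp [flip, h]
  have step2 : ∀ k σ, a * b ≤ Q k σ + Q k (flip k σ) := by
    intro k σ
    have e : Q k σ + Q k (flip k σ) =
        ∫⁻ ω in A k, ∫⁻ z in C k, (F σ ω z + F (flip k σ) ω z) ∂volume ∂P := by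
      simp only [hQ]
      rw [← lintegral_add_left (hGm σ k)]
      refine lintegral_congr fun ω => ?_
      exact (lintegral_add_left (f := fun z => F σ ω z) ((hFm σ).comp measurable_prodMk_left) _).symm
    rw [e]
    calc a * b ≤ P (A k) * b := by gcongr; exact hP k
      _ = ∫⁻ ω in A k, b ∂P := by rw [setLIntegral_const, mul_comm]
      _ ≤ _ := by
        refine setLIntegral_mono' (hAm k) fun ω hω => (hI k).trans (lintegral_mono fun z => ?_)
        have hd : (fun i => (ω i, f (flip k σ) (ω i))) = fun i => (ω i, f σ (ω i)) := by
          funext i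
          have := hff k σ (ω i)
          rw [hω i] at this
          have h0 : f σ (ω i) - f (flip k σ) (ω i) = 0 := by
            apply pow_eq_zero_iff (two_ne_zero) |>.1; simpa using this
          rw [sub_eq_zero.1 h0]
        simp only [hF]
        rw [hd, ← ENNReal.ofReal_add (sq_nonneg _) (sq_nonneg _)]
        apply ENNReal.ofReal_le_ofReal
        rw [← hff k σ z]
        nlinarith [sq_nonneg ((fhat (fun i => (ω i, f σ (ω i))) z - f σ z) +
          (fhat (fun i => (ω i, f σ (ω i))) z - f (flip k σ) z))]
  have step3 : ∀ k, (Fintype.card (ι → Bool) : ℝ≥0∞) * (a * b) ≤ 2 * ∑ σ, Q k σ := by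
    intro k
    have : ∑ σ, Q k (flip k σ) = ∑ σ, Q k σ :=
      Equiv.sum_comp (hflip k).toPerm (Q k)
    calc _ = ∑ σ : ι → Bool, a * b := by simp
      _ ≤ ∑ σ, (Q k σ + Q k (flip k σ)) := Finset.sum_le_sum fun σ _ => step2 k σ
      _ = _ := by rw [Finset.sum_add_distrib, this, two_mul]
  have step4 : (Fintype.card (ι → Bool) : ℝ≥0∞) * ((Fintype.card ι : ℝ≥0∞) * (a * b) / 2)
      ≤ ∑ σ, R σ := by
    have h2 : ∀ k, (Fintype.card (ι → Bool) : ℝ≥0∞) * (a * b) / 2 ≤ ∑ σ, Q k σ := by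
      intro k
      exact ENNReal.div_le_of_le_mul' (step3 k)
    calc _ = ∑ k : ι, (Fintype.card (ι → Bool) : ℝ≥0∞) * (a * b) / 2 := by
          rw [Finset.sum_const, Finset.card_univ, nsmul_eq_mul]
          simp only [div_eq_mul_inv]; ring
      _ ≤ ∑ k, ∑ σ, Q k σ := Finset.sum_le_sum fun k _ => h2 k
      _ = ∑ σ, ∑ k, Q k σ := Finset.sum_comm
      _ ≤ _ := Finset.sum_le_sum fun σ _ => step1 σ
  by_contra hcon
  push Not at hcon
  have : ∑ σ, R σ < ∑ σ : ι → Bool, ((Fintype.card ι : ℝ≥0∞) * (a * b) / 2) :=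
    ENNReal.sum_lt_sum_of_nonempty Finset.univ_nonempty fun σ _ => hcon σ
  rw [Finset.sum_const, Finset.card_univ, nsmul_eq_mul] at this
  exact absurd (this.trans_le step4) (lt_irrefl _)

lemma sum_eq_inner {d : ℕ} (u x : Euc d) : ∑ j, u j * x j = inner ℝ u x := by
  rw [PiLp.inner_apply]; simp [mul_comm]

lemma cap_rot {d : ℕ} (u v : Euc d) (h : ‖u‖ = ‖v‖) (S : Set ℝ) (hS : MeasurableSet S) :
    volume {z : Euc d | ‖z‖ ≤ 1 ∧ inner ℝ u z ∈ S} = volume {z : Euc d | ‖z‖ ≤ 1 ∧ inner ℝ v z ∈ S} := by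
  set ρ := (ℝ ∙ (u - v))ᗮ.reflection
  have hu : ρ u = v := Submodule.reflection_sub h
  have hmp := ρ.measurePreserving
  have hms : MeasurableSet {z : Euc d | ‖z‖ ≤ 1 ∧ inner ℝ v z ∈ S} := by
    apply MeasurableSet.inter
    · exact measurableSet_le measurable_norm measurable_const
    · exact (measurable_const.inner measurable_id) hS
  rw [← hmp.measure_preimage hms.nullMeasurableSet]
  congr 1
  ext z
  simp only [Set.mem_preimage, Set.mem_ofPred_eq, LinearIsometryEquiv.norm_map]
  rw [← hu, LinearIsometryEquiv.inner_map_map]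

lemma box_vol {d : ℕ} (i0 : Fin d) (a b m : ℝ) (hab : a ≤ b) (hm : 0 ≤ m) :
    volume {z : Euc d | z i0 ∈ Set.Icc a b ∧ ∀ i, i ≠ i0 → |z i| ≤ m}
      = ENNReal.ofReal ((b - a) * (2 * m) ^ (d - 1)) := by
  have hmp := EuclideanSpace.volume_preserving_symm_measurableEquiv_toLp (Fin d)
  set lo : Fin d → ℝ := fun i => if i = i0 then a else -m
  set hi : Fin d → ℝ := fun i => if i = i0 then b else m
  have e : {z : Euc d | z i0 ∈ Set.Icc a b ∧ ∀ i, i ≠ i0 → |z i| ≤ m} =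
      (MeasurableEquiv.toLp 2 (Fin d → ℝ)).symm ⁻¹' (Set.Icc lo hi) := by
    ext z
    simp only [Set.mem_ofPred_eq, Set.mem_preimage, Set.mem_Icc, Pi.le_def, lo, hi, abs_le]
    constructor
    · rintro ⟨⟨h1, h2⟩, h3⟩
      refine ⟨fun i => ?_, fun i => ?_⟩ <;> by_cases h : i = i0
      · subst h; simpa using h1
      · simpa [h] using (h3 i h).1
      · subst h; simpa using h2
      · simpa [h] using (h3 i h).2
    · rintro ⟨h1, h2⟩
      refine ⟨⟨by simpa using h1 i0, by simpa using h2 i0⟩, fun i h => ⟨by simpa [h] using h1 i, by simpa [h] using h2 i⟩⟩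
  rw [e, hmp.measure_preimage measurableSet_Icc.nullMeasurableSet, Real.volume_Icc_pi]
  rw [← ENNReal.ofReal_prod_of_nonneg]
  · congr 1
    rw [← Finset.mul_prod_erase _ _ (Finset.mem_univ i0)]
    congr 1
    · simp [hi, lo]
    · rw [Finset.prod_congr rfl (g := fun _ => 2 * m), Finset.prod_const]
      · simp [Finset.card_erase_of_mem]
      · intro i hi'
        simp [hi, lo, Finset.ne_of_mem_erase hi']; ring
  · intro i _
    by_cases h : i = i0 <;> simp [hi, lo, h, hab] 
    linarith

lemma norm_sq_split {d : ℕ} (i0 : Fin d) (z : Euc d) :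
    ‖z‖ ^ 2 = z i0 ^ 2 + ∑ i ∈ Finset.univ.erase i0, z i ^ 2 := by
  rw [EuclideanSpace.norm_sq_eq, ← Finset.add_sum_erase _ _ (Finset.mem_univ i0)]
  simp

lemma cap_upper {d : ℕ} (hd : 2 ≤ d) (u : Euc d) (hu : ‖u‖ = 1) (s : ℝ) (hs : 0 < s) (hs1 : s ≤ 1/2) :
    volume {z : Euc d | ‖z‖ ≤ 1 ∧ inner ℝ u z ∈ Set.Ici (1 - s ^ 2)}
      ≤ ENNReal.ofReal (4 ^ d * s ^ (d + 1)) := by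
  let i0 : Fin d := ⟨0, by omega⟩
  rw [cap_rot u (EuclideanSpace.single i0 1) (by simp [hu]) _ measurableSet_Ici]
  calc _ ≤ volume {z : Euc d | z i0 ∈ Set.Icc (1 - s ^ 2) 1 ∧ ∀ i, i ≠ i0 → |z i| ≤ 2 * s} := by
        apply measure_mono
        rintro z ⟨h1, h2⟩
        simp [EuclideanSpace.inner_single_left] at h2
        have h3 := norm_sq_split i0 z
        have h4 : ‖z‖ ^ 2 ≤ 1 := by nlinarith [norm_nonneg z]
        have h5 : 0 ≤ ∑ i ∈ Finset.univ.erase i0, z i ^ 2 := Finset.sum_nonneg fun _ _ => sq_nonneg _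
        refine ⟨⟨by linarith, by nlinarith⟩, fun i hi => ?_⟩
        have h6 : z i ^ 2 ≤ ∑ i ∈ Finset.univ.erase i0, z i ^ 2 :=
          Finset.single_le_sum (f := fun i => z i ^ 2) (fun _ _ => sq_nonneg _) (by simp [hi])
        refine abs_le_of_sq_le_sq ?_ (by linarith)
        have h7 : s ^ 2 ≤ 1 := by nlinarith
        have h8 : (1 - s ^ 2) ^ 2 ≤ z i0 ^ 2 := by
          apply pow_le_pow_left₀ <;> linarith
        nlinarith
    _ = ENNReal.ofReal (s ^ 2 * (4 * s) ^ (d - 1)) := by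
        rw [box_vol _ _ _ _ (by nlinarith) (by linarith)]; congr 1; ring
    _ ≤ _ := by
        apply ENNReal.ofReal_le_ofReal
        obtain ⟨e, rfl⟩ : ∃ e, d = e + 1 := ⟨d - 1, by omega⟩
        simp only [Nat.add_sub_cancel, mul_pow]
        have : 0 ≤ (4:ℝ) ^ e * s ^ (e + 2) := by positivity
        ring_nf at *; nlinarith

lemma cap_lower {d : ℕ} (hd : 2 ≤ d) (u : Euc d) (hu : ‖u‖ = 1) (s : ℝ) (hs : 0 < s) (hs1 : s ≤ 1/2) :
    ENNReal.ofReal (s ^ (d + 1) / (4 * d ^ d)) ≤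
    volume {z : Euc d | ‖z‖ ≤ 1 ∧ inner ℝ u z ∈ Set.Ici (1 - s ^ 2 / 2)} := by
  let i0 : Fin d := ⟨0, by omega⟩
  have hd' : (2:ℝ) ≤ d := by exact_mod_cast hd
  rw [cap_rot u (EuclideanSpace.single i0 1) (by simp [hu]) _ measurableSet_Ici]
  calc _ ≤ ENNReal.ofReal (s ^ 2 / 4 * (s / d) ^ (d - 1)) := by
        apply ENNReal.ofReal_le_ofReal
        obtain ⟨e, rfl⟩ : ∃ e, d = e + 1 := ⟨d - 1, by omega⟩
        simp only [Nat.add_sub_cancel, div_pow]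
        set D : ℝ := ((e + 1 : ℕ) : ℝ)
        rw [div_mul_div_comm, ← pow_add, show 2 + e = e + 1 + 1 by ring]
        gcongr
        · linarith
        · omega
    _ = volume {z : Euc d | z i0 ∈ Set.Icc (1 - s ^ 2 / 2) (1 - s ^ 2 / 4) ∧ ∀ i, i ≠ i0 → |z i| ≤ s / (2 * d)} := by
        rw [box_vol _ _ _ _ (by nlinarith) (by positivity)]; congr 1
        field_simp; ring
    _ ≤ _ := by
        apply measure_mono
        rintro z ⟨⟨h1, h2⟩, h3⟩
        refine ⟨?_, by simpa [EuclideanSpace.inner_single_left] using h1⟩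
        have h4 := norm_sq_split i0 z
        have h5 : ∑ i ∈ Finset.univ.erase i0, z i ^ 2 ≤ d * (s / (2 * d)) ^ 2 := by
          calc _ ≤ ∑ i ∈ Finset.univ.erase i0, (s / (2 * d)) ^ 2 := by
                refine Finset.sum_le_sum fun i hi => ?_
                exact sq_le_sq' (abs_le.1 (h3 i (Finset.ne_of_mem_erase hi))).1 (abs_le.1 (h3 i (Finset.ne_of_mem_erase hi))).2
            _ ≤ ∑ i : Fin d, (s / (2 * d)) ^ 2 := Finset.sum_le_sum_of_subset_of_nonneg (Finset.erase_subset _ _) fun _ _ _ => sq_nonneg _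
            _ = _ := by simp
        have h6 : d * (s / (2 * d)) ^ 2 ≤ s ^ 2 / 8 := by
          have : d * (s / (2 * d)) ^ 2 = s ^ 2 / (4 * d) := by field_simp; ring
          rw [this]; gcongr; linarith
        have h7 : z i0 ^ 2 ≤ (1 - s ^ 2 / 4) ^ 2 := by
          apply sq_le_sq' <;> nlinarith
        have h8 : s ^ 2 ≤ 1 := by nlinarith
        have : ‖z‖ ^ 2 ≤ 1 := by nlinarith [sq_nonneg s]
        nlinarith [norm_nonneg z]

lemma packing {d : ℕ} (hd : 2 ≤ d) (r : ℝ) (hr : 0 < r) (hr1 : r ≤ 1) (m : ℕ)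
    (hm : ((m : ℝ) - 1) * (2 * r) ^ d < r) :
    ∃ T : Finset (Euc d), T.card = m ∧ (∀ u ∈ T, ‖u‖ = 1) ∧
      ∀ u ∈ T, ∀ v ∈ T, u ≠ v → r ≤ ‖u - v‖ := by
  have hpos : 0 < (2 * r) ^ d := by positivity
  induction m with
  | zero => exact ⟨∅, by simp⟩
  | succ m ih =>
    push_cast at hm
    obtain ⟨T, hT, hn, hs⟩ := ih (by nlinarith)
    obtain ⟨v, hv, hvT⟩ : ∃ v : Euc d, ‖v‖ = 1 ∧ ∀ u ∈ T, r ≤ ‖u - v‖ := by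
      by_contra hcon
      push Not at hcon
      have hsub : Metric.closedBall (0 : Euc d) 1 ⊆
          Metric.closedBall 0 (1 - r) ∪ ⋃ u ∈ T, Metric.closedBall u (2 * r) := by
        intro x hx
        rw [mem_closedBall_zero_iff] at hx
        by_cases h : ‖x‖ ≤ 1 - r
        · left; simpa using h
        right
        push Not at h
        have hx0 : x ≠ 0 ∨ r = 1 := by
          by_cases h0 : x = 0
          · subst h0; right; simp at h; linarith
          · exact Or.inl h0
        have hx0 : x ≠ 0 := by
          rintro rfl; simp at h; linarith
        have hxp : 0 < ‖x‖ := norm_pos_iff.2 hx0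
        obtain ⟨u, hu, hur⟩ := hcon (‖x‖⁻¹ • x) (by rw [norm_smul]; simp; field_simp)
        simp only [Set.mem_iUnion]
        refine ⟨u, hu, ?_⟩
        rw [Metric.mem_closedBall, dist_eq_norm]
        have h2 : ‖x - ‖x‖⁻¹ • x‖ = 1 - ‖x‖ := by
          have : x - ‖x‖⁻¹ • x = (1 - ‖x‖⁻¹) • x := by rw [sub_smul, one_smul]
          rw [this, norm_smul, Real.norm_eq_abs, abs_of_nonpos]
          · field_simp; ring
          · have := (one_le_inv₀ hxp).2 hx; linarith
        calc ‖x - u‖ = ‖(x - ‖x‖⁻¹ • x) - (u - ‖x‖⁻¹ • x)‖ := by congr 1; abel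
          _ ≤ _ := norm_sub_le _ _
          _ ≤ 2 * r := by rw [h2]; linarith
      have hV := (measure_mono hsub).trans (measure_union_le (μ := volume) _ _)
      have hV2 := hV.trans (add_le_add_right (measure_biUnion_finset_le (μ := volume) T _) _)
      simp only [Measure.addHaar_closedBall volume _ (show (0:ℝ) ≤ 2 * r by linarith), Measure.addHaar_closedBall volume _ (show (0:ℝ) ≤ 1 - r by linarith), Measure.addHaar_closedBall volume _ (zero_le_one), finrank_euclideanSpace, Fintype.card_fin, Finset.sum_const, hT, nsmul_eq_mul] at hV2
      rw [← mul_assoc, ← add_mul, ENNReal.mul_le_mul_iff_left (Metric.measure_ball_pos volume _ one_pos).ne' measure_ball_lt_top.ne,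
        ← ENNReal.ofReal_natCast, ← ENNReal.ofReal_mul (by positivity), ← ENNReal.ofReal_add (pow_nonneg (by linarith) _) (by positivity), ENNReal.ofReal_le_ofReal_iff (add_nonneg (pow_nonneg (by linarith) _) (by positivity))] at hV2
      have h1 : (1 - r) ^ d ≤ (1 - r) ^ 1 := pow_le_pow_of_le_one (by linarith) (by linarith) (by omega)
      simp at h1 hV2
      linarith
    have hvn : v ∉ T := fun h => by have := hvT v h; simp at this; linarith
    refine ⟨insert v T, by simp [hvn, hT], ?_, ?_⟩
    · intro u hu
      rcases Finset.mem_insert.1 hu with rfl | h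
      exacts [hv, hn u h]
    · intro u hu w hw huw
      rcases Finset.mem_insert.1 hu with rfl | h <;> rcases Finset.mem_insert.1 hw with rfl | h'
      · exact absurd rfl huw
      · rw [norm_sub_rev]; exact hvT w h'
      · exact hvT u h
      · exact hs u h w h' huw

lemma vg_bound {d : ℕ} {ι : Type} [Fintype ι] (u : ι → Euc d) (hu : ∀ k, ‖u k‖ = 1)
    (δ : ℝ) (h0 : 0 < δ) (h1 : δ ≤ 1) (hc : (Fintype.card ι : ℝ) * δ ^ (d + 1) ≤ 1) (σ : ι → Bool) :
    VgSeminorm d 1 (gPow d)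
      (fun z => ∑ k, if σ k then relu (inner ℝ (u k) z - (1 - δ)) / δ else 0) ≤ 1 := by
  set w : ι → NNReal := fun k => if σ k then Real.toNNReal δ⁻¹ else 0 with hw
  set μ : Measure (Euc d × ℝ) := ∑ k, w k • Measure.dirac (u k, 1 - δ) with hμ
  let j : JordanDecomposition (Euc d × ℝ) :=
    { posPart := μ, negPart := 0, mutuallySingular := Measure.MutuallySingular.zero_right }
  have hj := j.toJordanDecomposition_toSignedMeasure
  have hμf : IsFiniteMeasure μ := j.posPart_finite
  have htv : j.toSignedMeasure.totalVariation = μ := by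
    rw [SignedMeasure.totalVariation, hj]; simp [j]
  refine sInf_le_of_le ⟨j.toSignedMeasure, 0, 0, ?_, ?_, rfl⟩ ?_
  · rw [htv, hμ]
    simp only [Measure.coe_finsetSum, Finset.sum_apply, Measure.smul_apply]
    refine Finset.sum_eq_zero fun k _ => ?_
    rw [Measure.dirac_apply' _ ((Metric.isClosed_sphere.measurableSet.prod measurableSet_Icc).compl)]
    rw [Set.indicator_of_notMem]
    · simp
    · simp [hu]; constructor <;> linarith
  · intro x hx
    rw [hj]
    simp only [j, integral_zero_measure]
    rw [hμ, integral_finsetSum_measure]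
    · simp only [integral_smul_nnreal_measure, integral_dirac, sum_eq_inner]
      simp only [inner_zero_left, sub_zero, add_zero]
      refine Finset.sum_congr rfl fun k _ => ?_
      by_cases h : σ k = true
      · simp [hw, h, NNReal.smul_def, h0.le]; ring
      · simp [hw, h]
    · intro k _
      apply Integrable.smul_measure_nnreal
      exact integrable_dirac (by simp)
  · rw [htv, hμ, lintegral_finsetSum_measure]
    calc _ ≤ ∑ k : ι, ENNReal.ofReal (δ ^ (d + 1)) := by
          refine Finset.sum_le_sum fun k _ => ?_
          rw [lintegral_smul_measure, lintegral_dirac]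
          have : gPow d (u k, 1 - δ) = δ ^ (d + 2) := by
            simp only [gPow]
            rw [abs_of_nonneg (by linarith), if_pos (by linarith)]; ring
          rw [this]
          by_cases h : σ k = true
          · simp only [hw, h, if_true]
            rw [ENNReal.smul_def, smul_eq_mul]
            change ENNReal.ofReal _ * _ ≤ _
            rw [← ENNReal.ofReal_mul (by positivity)]
            apply ENNReal.ofReal_le_ofReal
            apply le_of_eq; field_simp; ring
          · simp [hw, h]
      _ ≤ 1 := by
          rw [Finset.sum_const, Finset.card_univ, nsmul_eq_mul, ← ENNReal.ofReal_natCast, ← ENNReal.ofReal_mul (by positivity)]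
          rw [← ENNReal.ofReal_one]; exact ENNReal.ofReal_le_ofReal hc

lemma cap_disj {d : ℕ} (u v z : Euc d) (hu : ‖u‖ = 1) (hv : ‖v‖ = 1) (s : ℝ) (hs : 0 < s)
    (huv : 3 * s ≤ ‖u - v‖) (hz : ‖z‖ ≤ 1) (h1 : 1 - s ^ 2 < inner ℝ u z)
    (h2 : 1 - s ^ 2 < inner ℝ v z) : False := by
  have key : ∀ w : Euc d, ‖w‖ = 1 → 1 - s ^ 2 < inner ℝ w z → ‖w - z‖ < 3 / 2 * s := by
    intro w hw h
    have := norm_sub_sq_real w z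
    rw [hw] at this
    have h3 : ‖z‖ ^ 2 ≤ 1 := by nlinarith [norm_nonneg z]
    apply lt_of_pow_lt_pow_left₀ 2 (by positivity)
    nlinarith
  have a := key u hu h1
  have b := key v hv h2
  have : ‖u - v‖ ≤ ‖u - z‖ + ‖v - z‖ := by
    calc ‖u - v‖ = ‖(u - z) - (v - z)‖ := by congr 1; abel
      _ ≤ _ := norm_sub_le _ _
  linarith

lemma unif_cap {d : ℕ} (hd : 2 ≤ d) (u : Euc d) (hu : ‖u‖ = 1) (s : ℝ) (hs : 0 < s)
    (hs1 : s ≤ 1/2) (n : ℕ) (hn : 1 ≤ n)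
    (h : 4 ^ d * s ^ (d + 1) ≤ (volume (Metric.closedBall (0 : Euc d) 1)).toReal / (2 * n)) :
    ENNReal.ofReal (1 / 2) ≤ (Measure.pi fun _ : Fin n => uniformBall d)
      {ω | ∀ i, relu (inner ℝ u (ω i) - (1 - s ^ 2)) / s ^ 2 = 0} := by
  set H : Set (Euc d) := {z | inner ℝ u z ∈ Set.Ici (1 - s ^ 2)} with hH
  have hHm : MeasurableSet H := (measurable_const.inner measurable_id) measurableSet_Ici
  have hn' : (1:ℝ) ≤ n := by exact_mod_cast hn
  set W := (volume (Metric.closedBall (0 : Euc d) 1)) with hW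
  have hW0 : W ≠ 0 := (Metric.measure_closedBall_pos volume (0 : Euc d) one_pos).ne'
  have hWt : W ≠ ∞ := (isCompact_closedBall _ _).measure_lt_top.ne
  have hμH : uniformBall d H ≤ ENNReal.ofReal (1 / (2 * n)) := by
    rw [uniformBall, Measure.smul_apply, Measure.restrict_apply hHm, smul_eq_mul, ← hW]
    have e : H ∩ Metric.closedBall 0 1 = {z : Euc d | ‖z‖ ≤ 1 ∧ inner ℝ u z ∈ Set.Ici (1 - s ^ 2)} := by
      ext z; simp [hH, and_comm]
    rw [e]
    calc _ ≤ W⁻¹ * ENNReal.ofReal (W.toReal / (2 * n)) := by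
          gcongr
          exact (cap_upper hd u hu s hs hs1).trans (ENNReal.ofReal_le_ofReal h)
      _ = W⁻¹ * (W * ENNReal.ofReal (1 / (2 * n))) := by
          rw [div_eq_mul_one_div, ENNReal.ofReal_mul ENNReal.toReal_nonneg, ENNReal.ofReal_toReal hWt]
      _ = _ := by rw [← mul_assoc, ENNReal.inv_mul_cancel hW0 hWt, one_mul]
  have hle : 1 / (2 * (n:ℝ)) ≤ 1 / 2 := by
    apply one_div_le_one_div_of_le <;> linarith
  have hc : ENNReal.ofReal (1 - 1 / (2 * n)) ≤ uniformBall d Hᶜ := by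
    rw [prob_compl_eq_one_sub hHm, ENNReal.ofReal_sub _ (by positivity), ENNReal.ofReal_one]
    exact tsub_le_tsub_left hμH _
  calc ENNReal.ofReal (1 / 2) ≤ ENNReal.ofReal ((1 - 1 / (2 * n)) ^ n) := by
        apply ENNReal.ofReal_le_ofReal
        have := one_add_mul_le_pow (a := -(1 / (2 * (n:ℝ)))) (by linarith) n
        have e : (n:ℝ) * -(1 / (2 * (n:ℝ))) = -(1/2) := by field_simp
        rw [e] at this
        rw [sub_eq_add_neg]; linarith
    _ = ENNReal.ofReal (1 - 1 / (2 * n)) ^ n := ENNReal.ofReal_pow (by linarith) _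
    _ ≤ (uniformBall d Hᶜ) ^ n := by gcongr
    _ = (Measure.pi fun _ : Fin n => uniformBall d) (Set.pi Set.univ fun _ => Hᶜ) := by
        rw [Measure.pi_pi]; simp
    _ ≤ _ := by
        apply measure_mono
        intro ω hω i
        have := hω i (Set.mem_univ i)
        simp [hH] at this
        have : inner ℝ u (ω i) - (1 - s ^ 2) ≤ 0 := by linarith
        simp [relu, this]

lemma int_cap {d : ℕ} (hd : 2 ≤ d) (u : Euc d) (hu : ‖u‖ = 1) (s : ℝ) (hs : 0 < s)
    (hs1 : s ≤ 1/2) :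
    ENNReal.ofReal (1 / 8 * (s ^ (d + 1) / (4 * d ^ d))) ≤
      ∫⁻ z in {z : Euc d | ‖z‖ ≤ 1 ∧ inner ℝ u z ∈ Set.Ioi (1 - s ^ 2)},
        ENNReal.ofReal ((relu (inner ℝ u z - (1 - s ^ 2)) / s ^ 2) ^ 2 / 2) := by
  set D := {z : Euc d | ‖z‖ ≤ 1 ∧ inner ℝ u z ∈ Set.Ici (1 - s ^ 2 / 2)}
  have hD : MeasurableSet D := by
    apply MeasurableSet.inter
    · exact measurableSet_le measurable_norm measurable_const
    · exact (measurable_const.inner measurable_id) measurableSet_Ici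
  have hs2 : 0 < s ^ 2 := by positivity
  calc _ ≤ ENNReal.ofReal (1 / 8) * volume D := by
        rw [ENNReal.ofReal_mul (by norm_num)]
        gcongr
        exact cap_lower hd u hu s hs hs1
    _ = ∫⁻ z in D, ENNReal.ofReal (1 / 8) := by rw [setLIntegral_const]
    _ ≤ ∫⁻ z in D, ENNReal.ofReal ((relu (inner ℝ u z - (1 - s ^ 2)) / s ^ 2) ^ 2 / 2) := by
        refine setLIntegral_mono' hD fun z hz => ENNReal.ofReal_le_ofReal ?_
        have h1 : 1 - s ^ 2 / 2 ≤ inner ℝ u z := hz.2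
        have h2 : 1 / 2 ≤ relu (inner ℝ u z - (1 - s ^ 2)) / s ^ 2 := by
          rw [le_div_iff₀ hs2]
          exact le_trans (by linarith) (le_max_left _ _)
        nlinarith
    _ ≤ _ := by
        apply lintegral_mono_set
        rintro z ⟨h1, h2⟩
        have h2 : 1 - s ^ 2 / 2 ≤ inner ℝ u z := h2
        exact ⟨h1, show 1 - s ^ 2 < inner ℝ u z by linarith⟩

set_option maxHeartbeats 2000000 in
/-- **Noiseless minimax lower bound (Corollary `coro: Strong_Lower_Bound`).** -/
theorem noiseless_minimax_lower_bound
    (d : ℕ) (hd : 2 ≤ d) :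
    ∃ c > (0 : ℝ), ∃ n₀ : ℕ, ∀ n ≥ n₀,
      ∀ fhat : (Fin n → Euc d × ℝ) → Euc d → ℝ,
        Measurable (fun p : (Fin n → Euc d × ℝ) × Euc d => fhat p.1 p.2) →
        ∃ f : Euc d → ℝ,
          (∀ z ∈ Metric.closedBall (0 : Euc d) 1, |f z| ≤ 1) ∧
          VgSeminorm d 1 (gPow d) f ≤ 1 ∧
          ENNReal.ofReal (c * (n : ℝ) ^ (-(2 : ℝ) / ((d : ℝ) + 1))) ≤
            ∫⁻ ω, ∫⁻ z in Metric.closedBall (0 : Euc d) 1,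
                ENNReal.ofReal ((fhat (fun i => (ω i, f (ω i))) z - f z) ^ 2) ∂volume
              ∂(Measure.pi fun _ : Fin n => uniformBall d) := by
  set W := (volume (Metric.closedBall (0 : Euc d) 1)).toReal with hW
  have hWp : 0 < W := ENNReal.toReal_pos
    (Metric.measure_closedBall_pos volume (0 : Euc d) one_pos).ne'
    (isCompact_closedBall _ _).measure_lt_top.ne
  set κ : ℝ := min (1 / 3) (W / (2 * 4 ^ d)) with hκ
  have hκp : 0 < κ := lt_min (by norm_num) (by positivity)
  have hκ1 : κ ≤ 1 / 3 := min_le_left _ _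
  have hκ2 : κ ≤ W / (2 * 4 ^ d) := min_le_right _ _
  have hdR : (2:ℝ) ≤ d := by exact_mod_cast hd
  refine ⟨κ ^ 2 * (3 / (6 ^ d * 128 * d ^ d)), by positivity, 1, ?_⟩
  intro n hn fhat hm
  have hn' : (1:ℝ) ≤ n := by exact_mod_cast hn
  have hn0 : (0:ℝ) < n := by linarith
  set q : ℝ := (n : ℝ) ^ (-(1 : ℝ) / ((d : ℝ) + 1)) with hq
  have hqp : 0 < q := Real.rpow_pos_of_pos hn0 _
  have hq1 : q ≤ 1 := by
    apply Real.rpow_le_one_of_one_le_of_nonpos hn'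
    apply div_nonpos_of_nonpos_of_nonneg <;> linarith
  have hqd : q ^ (d + 1) = 1 / n := by
    rw [hq, ← Real.rpow_natCast, ← Real.rpow_mul hn0.le]
    push_cast
    rw [div_mul_cancel₀ _ (by linarith), Real.rpow_neg_one, one_div]
  have hq2 : (n : ℝ) ^ (-(2 : ℝ) / ((d : ℝ) + 1)) = q ^ 2 := by
    rw [hq, ← Real.rpow_natCast, ← Real.rpow_mul hn0.le]
    congr 1; push_cast; ring
  rw [hq2]
  set s : ℝ := κ * q with hs
  have hsp : 0 < s := by positivity
  have hs3 : s ≤ 1 / 3 := by nlinarith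
  have hs12 : s ≤ 1 / 2 := by linarith
  have hsV : 4 ^ d * s ^ (d + 1) ≤ W / (2 * n) := by
    rw [hs, mul_pow, hqd]
    have h1 : κ ^ (d + 1) ≤ κ := by
      calc κ ^ (d + 1) ≤ κ ^ 1 := pow_le_pow_of_le_one hκp.le (by linarith) (by omega)
        _ = κ := pow_one κ
    calc 4 ^ d * (κ ^ (d + 1) * (1 / n)) ≤ 4 ^ d * (W / (2 * 4 ^ d) * (1 / n)) := by
          gcongr; exact h1.trans hκ2
      _ = W / (2 * n) := by field_simp
  set r : ℝ := 3 * s with hr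
  have hrp : 0 < r := by positivity
  have hr1 : r ≤ 1 := by linarith
  have h2r : 0 < (2 * r) ^ d := by positivity
  set m : ℕ := ⌈r / (2 * r) ^ d⌉₊ with hmdef
  have hm1 : (m : ℝ) < r / (2 * r) ^ d + 1 := Nat.ceil_lt_add_one (by positivity)
  have hm2 : r / (2 * r) ^ d ≤ m := Nat.le_ceil _
  obtain ⟨T, hT, hTn, hTs⟩ := packing hd r hrp hr1 m (by
    rw [← lt_div_iff₀ h2r]; linarith)
  have hcard : (Fintype.card T : ℝ) = m := by rw [Fintype.card_coe, hT]
  have hbound : (Fintype.card T : ℝ) * (s ^ 2) ^ (d + 1) ≤ 1 := by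
    rw [hcard]
    have h1 : (m : ℝ) * (2 * r) ^ d ≤ r + (2 * r) ^ d := by
      have := mul_le_mul_of_nonneg_right hm1.le h2r.le
      rwa [add_mul, div_mul_cancel₀ _ h2r.ne', one_mul] at this
    have hsle : s ^ d ≤ (2 * r) ^ d := by
      apply pow_le_pow_left₀ hsp.le; linarith
    have h3 : s ^ (d + 2) ≤ s ^ 2 := pow_le_pow_of_le_one hsp.le (by linarith) (by omega)
    have h4 : s ^ d ≤ 1 := pow_le_one₀ hsp.le (by linarith)
    have h5 : s ^ 2 ≤ 1 / 9 := by nlinarith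
    have e1 : (s ^ 2) ^ (d + 1) = s ^ d * s ^ (d + 2) := by ring
    have hsd : 0 < s ^ d := by positivity
    -- m * s^d ≤ r + 1
    have h6 : (m : ℝ) * s ^ d ≤ 2 := by
      have : (m:ℝ) * s ^ d ≤ (r / (2 * r) ^ d + 1) * s ^ d := by gcongr
      have h7 : r / (2 * r) ^ d * s ^ d ≤ r := by
        rw [div_mul_eq_mul_div, div_le_iff₀ h2r]
        gcongr
      nlinarith
    rw [e1, ← mul_assoc]
    have h8 : 0 < s ^ (d + 2) := by positivity
    nlinarith
  set φ : T → Euc d → ℝ := fun k z => relu (inner ℝ k.1 z - (1 - s ^ 2)) / s ^ 2 with hφ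
  have hφm : ∀ k, Measurable (φ k) := by
    intro k
    apply Measurable.div_const
    exact ((measurable_const.inner measurable_id).sub_const _).max measurable_const
  have hTnn : ∀ k : T, ‖k.1‖ = 1 := fun k => hTn k.1 k.2
  obtain ⟨σ, hσ⟩ := assouad fhat hm φ hφm
    (fun k => {z : Euc d | ‖z‖ ≤ 1 ∧ inner ℝ k.1 z ∈ Set.Ioi (1 - s ^ 2)})
    (by
      intro k
      apply MeasurableSet.inter
      · exact measurableSet_le measurable_norm measurable_const
      · exact (measurable_const.inner measurable_id) measurableSet_Ioi)
    (by
      intro k l hkl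
      rw [Set.disjoint_left]
      rintro z ⟨hz, h1⟩ ⟨_, h2⟩
      exact cap_disj k.1 l.1 z (hTnn k) (hTnn l) s hsp
        (hTs k.1 k.2 l.1 l.2 (fun h => hkl (Subtype.ext h))) hz h1 h2)
    (by rintro k z ⟨hz, _⟩; simpa using hz)
    (uniformBall d) (ENNReal.ofReal (1 / 2))
    (ENNReal.ofReal (1 / 8 * (s ^ (d + 1) / (4 * d ^ d))))
    (fun k => unif_cap hd k.1 (hTnn k) s hsp hs12 n hn hsV)
    (fun k => int_cap hd k.1 (hTnn k) s hsp hs12)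
  refine ⟨fun z => ∑ k, if σ k then φ k z else 0, ?_, ?_, ?_⟩
  · intro z hz
    rw [mem_closedBall_zero_iff] at hz
    beta_reduce
    have hφ0 : ∀ k, 0 ≤ φ k z := fun k => div_nonneg (le_max_right _ _) (by positivity)
    have hφ1 : ∀ k, φ k z ≤ 1 := by
      intro k
      have h1 : inner ℝ k.1 z ≤ 1 := by
        have := real_inner_le_norm k.1 z
        rw [hTnn k] at this; linarith
      simp only [hφ]
      rw [div_le_one (by positivity)]
      exact max_le (by linarith) (by positivity)
    by_cases hex : ∃ k : T, φ k z ≠ 0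
    · obtain ⟨k, hk⟩ := hex
      have hpos : ∀ l, φ l z ≠ 0 → 1 - s ^ 2 < inner ℝ l.1 z := by
        intro l hl
        by_contra h
        apply hl
        have : inner ℝ l.1 z - (1 - s ^ 2) ≤ 0 := by linarith
        simp [hφ, relu, this]
      rw [Finset.sum_eq_single k]
      · by_cases h : σ k = true
        · simp only [h, if_true]; rw [abs_of_nonneg (hφ0 k)]; exact hφ1 k
        · simp [h]
      · intro l _ hlk
        have : φ l z = 0 := by
          by_contra hl
          exact cap_disj k.1 l.1 z (hTnn k) (hTnn l) s hsp
            (hTs k.1 k.2 l.1 l.2 (fun h => hlk (Subtype.ext h).symm)) hz (hpos k hk) (hpos l hl)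
        simp [this]
      · simp
    · push Not at hex
      simp [hex]
  · exact vg_bound (fun k : T => k.1) hTnn (s ^ 2) (by positivity) (by nlinarith) hbound σ
  · refine le_trans ?_ hσ
    rw [← ENNReal.ofReal_mul (by norm_num), ← ENNReal.ofReal_natCast (Fintype.card T),
      ← ENNReal.ofReal_mul (by positivity), ← ENNReal.ofReal_ofNat 2,
      ← ENNReal.ofReal_div_of_pos (by norm_num), hcard]
    apply ENNReal.ofReal_le_ofReal
    calc κ ^ 2 * (3 / (6 ^ d * 128 * d ^ d)) * q ^ 2
        = r / (2 * r) ^ d * (1 / 2 * (1 / 8 * (s ^ (d + 1) / (4 * d ^ d)))) / 2 := by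
          have e1 : (2 * r) ^ d = 6 ^ d * s ^ d := by rw [hr, ← mul_pow]; ring
          have e2 : κ ^ 2 * (3 / (6 ^ d * 128 * d ^ d)) * q ^ 2
            = s ^ 2 * (3 / (6 ^ d * 128 * d ^ d)) := by rw [hs]; ring
          rw [e1, e2, hr]
          field_simp
          ring
      _ ≤ _ := by gcongr

end
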